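/- arXiv:2307.09486 — 2 statements merged into one kernel-verified Lean document; each statement's English description precedes it below -/
import Mathlib

section
/- Let k ≥ 2 and suppose nonnegative integers n ≥ m ≥ l ≥ 0, d ≥ 2, 1 ≤ a ≤ 9 satisfy L_n^{(k)} · L_m^{(k)} · L_l^{(k)} = a·(10^d − 1)/9. Then |α^{−(n+m+l−3)} · 10^d · f_k(α)^{−3} · (2α − 1)^{−3} · (a/9) − 1| < 15/α^{l−3}, where α is the dominant root of x^k − x^{k−1} − ⋯ − x − 1. -/
/-- The `k`-generalized Lucas sequence: `L 0 = 2`, `L 1 = 1`, and for `n ≥ 2`,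
`L n = L (n-1) + L (n-2) + ⋯ + L (n-k)`, where terms with negative index count as `0`. -/
def lucasK (k : ℕ) : ℕ → ℕ
  | 0 => 2
  | 1 => 1
  | n + 2 => ∑ j ∈ Finset.range k, if _ : j ≤ n + 1 then lucasK k (n + 1 - j) else 0
termination_by n => n
decreasing_by omega

/-- A solution of the recurrence with no dominant component is bounded by its initial window. -/
theorem window_bound (k : ℕ) (α β B : ℝ) (hβ : 0 < β) (hαβ : α * β = 1)
    (hk : β ^ k = 2 - α) (hsum : ∑ j ∈ Finset.range k, β ^ (j + 1) = 1) (e : ℕ → ℝ)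
    (hrec : ∀ n, e (n + k) = ∑ j ∈ Finset.range k, e (n + j))
    (h0 : ∑ j ∈ Finset.range k, (1 - β ^ (j + 1)) * e j = 0)
    (hB : ∀ j < k, |e j| ≤ B) (n : ℕ) : |e n| ≤ B := by
  have hT : ∀ n, ∑ j ∈ Finset.range k, (1 - β ^ (j + 1)) * e (n + j) = 0 := by
    intro n
    induction n with
    | zero => simpa using h0
    | succ n ih =>
      have h1 : ∑ j ∈ Finset.range k, (1 - β ^ (j + 1)) * e (n + 1 + j)
          = ∑ j ∈ Finset.range (k + 1), (1 - β ^ j) * e (n + j) := by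
        rw [Finset.sum_range_succ']
        simp only [pow_zero, sub_self, zero_mul, add_zero]
        refine Finset.sum_congr rfl fun j _ => ?_
        rw [show n + 1 + j = n + (j + 1) by ring]
      rw [h1, Finset.sum_range_succ]
      have h2 : ∑ j ∈ Finset.range k, (1 - β ^ j) * e (n + j)
          = α * ∑ j ∈ Finset.range k, (1 - β ^ (j + 1)) * e (n + j)
            + (1 - α) * ∑ j ∈ Finset.range k, e (n + j) := by
        rw [Finset.mul_sum, Finset.mul_sum, ← Finset.sum_add_distrib]
        refine Finset.sum_congr rfl fun j _ => ?_
        rw [pow_succ]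
        linear_combination (β ^ j * e (n + j)) * hαβ
      rw [h2, ih, ← hrec, hk]
      ring
  induction n using Nat.strong_induction_on with
  | _ n ih =>
    by_cases hn : n < k
    · exact hB n hn
    · obtain ⟨i, rfl⟩ : ∃ i, n = i + k := ⟨n - k, by omega⟩
      have h3 : e (i + k) = ∑ j ∈ Finset.range k, β ^ (j + 1) * e (i + j) := by
        rw [hrec]
        have := hT i
        simp only [sub_mul, one_mul, Finset.sum_sub_distrib] at this
        linarith
      rw [h3]
      calc |∑ j ∈ Finset.range k, β ^ (j + 1) * e (i + j)|
          ≤ ∑ j ∈ Finset.range k, |β ^ (j + 1) * e (i + j)| := Finset.abs_sum_le_sum_abs _ _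
        _ ≤ ∑ j ∈ Finset.range k, β ^ (j + 1) * B := by
          refine Finset.sum_le_sum fun j hj => ?_
          rw [abs_mul, abs_of_pos (pow_pos hβ _)]
          have := Finset.mem_range.1 hj
          exact mul_le_mul_of_nonneg_left (ih _ (by omega)) (pow_pos hβ _).le
        _ = B := by rw [← Finset.sum_mul, hsum, one_mul]

/-- Shifted sequence, including the vanishing terms of negative index. -/
def lucasShift (k i : ℕ) : ℝ := if i + 2 < k then 0 else (lucasK k (i + 2 - k) : ℝ)

theorem lucasShift_rec (k : ℕ) (hk : 2 ≤ k) (i : ℕ) :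
    lucasShift k (i + k) = ∑ j ∈ Finset.range k, lucasShift k (i + j) := by
  rw [← Finset.sum_range_reflect]
  unfold lucasShift
  rw [if_neg (by omega), show i + k + 2 - k = i + 2 by omega, lucasK]
  push_cast
  refine Finset.sum_congr rfl fun j hj => ?_
  have := Finset.mem_range.1 hj
  by_cases h : j ≤ i + 1
  · rw [dif_pos h, if_neg (by omega), show i + (k - 1 - j) + 2 - k = i + 1 - j by omega]
  · rw [dif_neg h, if_pos (by omega)]
    simp

theorem root_facts (k : ℕ) (hk : 2 ≤ k) (α : ℝ) (hroot : α ^ k = ∑ i ∈ Finset.range k, α ^ i)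
    (hα₁ : 2 * (1 - (2 : ℝ) ^ (-(k : ℤ))) < α) (hα₂ : α < 2) :
    α ^ k * (2 - α) = 1 ∧ 1.6 < α ∧ 0 < 2 + ((k : ℝ) + 1) * (α - 2) ∧
    1 < (α - 1) / (2 + ((k : ℝ) + 1) * (α - 2)) * (2 * α - 1) ∧
    (α - 1) / (2 + ((k : ℝ) + 1) * (α - 2)) * (2 * α - 1) < 3 := by
  have h1 : α ^ k * (2 - α) = 1 := by
    have := mul_neg_geom_sum α k
    rw [← hroot] at this
    linarith
  refine ⟨h1, ?_⟩
  rcases Nat.lt_or_ge 2 k with h | h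
  · have hp : (0 : ℝ) < 2 ^ k := by positivity
    have hz : (2 : ℝ) ^ (-(k : ℤ)) = 1 / 2 ^ k := by simp
    rw [hz] at hα₁
    have hk8 : ∀ k : ℕ, 3 ≤ k → 8 * (k : ℝ) ≤ 3 * 2 ^ k := by
      intro k hk
      induction k, hk using Nat.le_induction with
      | base => norm_num
      | succ k hk ih =>
        rw [pow_succ]; push_cast
        have : (3 : ℝ) ≤ k := by exact_mod_cast hk
        linarith
    have h8 := hk8 k h
    have hk3 : (3 : ℝ) ≤ k := by exact_mod_cast h
    have hkz : (k : ℝ) * (1 / 2 ^ k) ≤ 3 / 8 := by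
      rw [mul_one_div, div_le_div_iff₀ hp (by norm_num)]; linarith
    have hz0 : (0 : ℝ) < 1 / 2 ^ k := by positivity
    set z : ℝ := 1 / 2 ^ k
    have hα : 1.75 < α := by nlinarith
    have hkα : (k : ℝ) * (2 - α) ≤ 3 / 4 := by nlinarith
    have hkα0 : 0 < (k : ℝ) * (2 - α) := by apply mul_pos <;> linarith
    have hD : 1 < 2 + ((k : ℝ) + 1) * (α - 2) := by nlinarith
    have hD' : 2 + ((k : ℝ) + 1) * (α - 2) < α := by nlinarith
    set D := 2 + ((k : ℝ) + 1) * (α - 2)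
    refine ⟨by linarith, by linarith, ?_, ?_⟩
    · rw [div_mul_eq_mul_div, lt_div_iff₀ (by linarith)]; nlinarith
    · rw [div_mul_eq_mul_div, div_lt_iff₀ (by linarith)]; nlinarith
  · obtain rfl : k = 2 := by omega
    norm_num [Finset.sum_range_succ] at hroot hα₁ ⊢
    have hα : 1.6 < α := by nlinarith
    have hD : 0 < 2 + 3 * (α - 2) := by linarith
    have e3 : (2 + 1 : ℝ) = 3 := by norm_num
    refine ⟨by linarith, by linarith, ?_, ?_⟩
    · rw [div_mul_eq_mul_div, lt_div_iff₀ (by linarith)]; nlinarith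
    · rw [div_mul_eq_mul_div, div_lt_iff₀ (by linarith)]; nlinarith

theorem lucas_error (k : ℕ) (hk : 2 ≤ k) (α c : ℝ)
    (hroot : α ^ k = ∑ i ∈ Finset.range k, α ^ i)
    (h1 : α ^ k * (2 - α) = 1) (hα : 1.6 < α) (hα₂ : α < 2)
    (hc : c * (2 + ((k : ℝ) + 1) * (α - 2)) = (α - 1) * (2 * α - 1))
    (hc1 : 1 < c) (hc3 : c < 3) (n : ℕ) : |(lucasK k n : ℝ) - c / α * α ^ n| ≤ 2 := by
  have hα0 : 0 < α := by linarith
  have hβ : 0 < α⁻¹ := by positivity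
  have hαβ : α * α⁻¹ = 1 := mul_inv_cancel₀ hα0.ne'
  have hβk : α⁻¹ ^ k = 2 - α := by
    rw [inv_pow]; exact inv_eq_of_mul_eq_one_right h1
  have hsum : ∑ j ∈ Finset.range k, α⁻¹ ^ (j + 1) = 1 := by
    have : (α⁻¹ - 1) * ∑ j ∈ Finset.range k, α⁻¹ ^ j = α⁻¹ ^ k - 1 := mul_geom_sum _ _
    have h2 : ∑ j ∈ Finset.range k, α⁻¹ ^ (j + 1) = (∑ j ∈ Finset.range k, α⁻¹ ^ j) * α⁻¹ := by
      rw [Finset.sum_mul]; rfl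
    rw [h2]
    rw [hβk] at this
    set S := ∑ j ∈ Finset.range k, α⁻¹ ^ j
    have h3 : (1 - α) * (S * α⁻¹) = 1 - α := by linear_combination this - S * hαβ
    exact mul_left_cancel₀ (by linarith : (1 - α) ≠ 0) (by linarith)
  obtain ⟨K, rfl⟩ : ∃ K, k = K + 2 := ⟨k - 2, by omega⟩
  have key := window_bound (K + 2) α α⁻¹ 2 hβ hαβ hβk hsum
    (fun i => lucasShift (K + 2) i - c * α * (2 - α) * α ^ i) ?_ ?_ ?_ (n + K)
  · simp only [lucasShift] at key
    rw [if_neg (by omega), show n + K + 2 - (K + 2) = n by omega] at key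
    convert key using 3
    field_simp
    rw [pow_add]
    linear_combination (-α ^ n) * h1
  · intro i
    rw [lucasShift_rec _ hk, Finset.sum_sub_distrib, ← Finset.mul_sum]
    congr 2
    rw [pow_add, hroot, Finset.mul_sum]
    exact Finset.sum_congr rfl fun j _ => by rw [pow_add]
  · have hG : ∑ j ∈ Finset.range (K + 2), (1 - α⁻¹ ^ (j + 1)) * lucasShift (K + 2) j
        = (α - 1) * (2 * α - 1) := by
      rw [Finset.sum_range_succ, Finset.sum_range_succ, Finset.sum_eq_zero]
      · have e1 : lucasShift (K + 2) K = 2 := by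
          unfold lucasShift
          rw [if_neg (by omega), Nat.sub_self, lucasK]; norm_num
        have e2 : lucasShift (K + 2) (K + 1) = 1 := by
          unfold lucasShift
          rw [if_neg (by omega), show K + 1 + 2 - (K + 2) = 1 by omega, lucasK]; norm_num
        have e3 : α⁻¹ ^ (K + 1) = α * (2 - α) := by
          rw [← hβk, pow_succ _ (K + 1)]
          linear_combination (-α⁻¹ ^ (K + 1)) * hαβ
        rw [e1, e2, show K + 1 + 1 = K + 2 by rfl, hβk, e3]; ring
      · intro j hj
        have := Finset.mem_range.1 hj
        unfold lucasShift
        rw [if_pos (by omega), mul_zero]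
    have hA : ∑ j ∈ Finset.range (K + 2), (1 - α⁻¹ ^ (j + 1)) * α ^ j
        = α ^ (K + 2) - (K + 2 : ℕ) * α⁻¹ := by
      rw [hroot]
      have : ∀ j ∈ Finset.range (K + 2), (1 - α⁻¹ ^ (j + 1)) * α ^ j = α ^ j - α⁻¹ := by
        intro j _
        have : α ^ j * α⁻¹ ^ j = 1 := by rw [← mul_pow, hαβ, one_pow]
        rw [pow_succ]
        linear_combination (-α⁻¹) * this
      rw [Finset.sum_congr rfl this, Finset.sum_sub_distrib]
      simp
    have : ∑ j ∈ Finset.range (K + 2), (1 - α⁻¹ ^ (j + 1)) *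
        (lucasShift (K + 2) j - c * α * (2 - α) * α ^ j)
        = (∑ j ∈ Finset.range (K + 2), (1 - α⁻¹ ^ (j + 1)) * lucasShift (K + 2) j)
          - c * α * (2 - α) * ∑ j ∈ Finset.range (K + 2), (1 - α⁻¹ ^ (j + 1)) * α ^ j := by
      rw [Finset.mul_sum, ← Finset.sum_sub_distrib]
      exact Finset.sum_congr rfl fun j _ => by ring
    rw [this, hG, hA]
    linear_combination (-hc) - c * α * h1 + c * (2 - α) * ((K + 2 : ℕ) : ℝ) * hαβ
  · intro j hj
    have hK : α ^ K * (2 - α) * α ^ 2 = 1 := by rw [← h1]; ring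
    rcases Nat.lt_or_ge j K with h | h
    · have e0 : lucasShift (K + 2) j = 0 := by
        unfold lucasShift; rw [if_pos (by omega)]
      have hle : α ^ j * α ≤ α ^ K := by
        rw [← pow_succ]; exact pow_le_pow_right₀ (by linarith) (by omega)
      rw [e0, zero_sub, abs_neg, abs_of_nonneg (by
        have : 0 < 2 - α := by linarith
        positivity)]
      have h2 : (2 - α) * (α ^ j * α) ≤ (2 - α) * α ^ K :=
        mul_le_mul_of_nonneg_left hle (by linarith)
      have h3 : (2 - α) * α ^ K ≤ 1 / 2 := by
        nlinarith [mul_nonneg (by linarith : 0 ≤ 2 - α) (pow_pos hα0 K).le]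
      have h4 : c * ((2 - α) * (α ^ j * α)) ≤ c * (1 / 2) :=
        mul_le_mul_of_nonneg_left (by linarith) (by linarith)
      nlinarith
    · obtain rfl | rfl : j = K ∨ j = K + 1 := by omega
      · have e1 : lucasShift (j + 2) j = 2 := by
          unfold lucasShift
          rw [if_neg (by omega), Nat.sub_self, lucasK]; norm_num
        have h5 : c * α * (2 - α) * α ^ j = c * α⁻¹ := by
          linear_combination (c * α⁻¹) * hK - c * α * (2 - α) * α ^ j * hαβ
        rw [e1, h5]
        have : α⁻¹ ≤ 1 := inv_le_one_of_one_le₀ (by linarith)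
        rw [abs_le]; constructor <;> nlinarith
      · have e2 : lucasShift (K + 2) (K + 1) = 1 := by
          unfold lucasShift
          rw [if_neg (by omega), show K + 1 + 2 - (K + 2) = 1 by omega, lucasK]; norm_num
        have h5 : c * α * (2 - α) * α ^ (K + 1) = c := by
          linear_combination c * hK
        rw [e2, h5, abs_le]; constructor <;> linarith

theorem final_ineq_pos (A B C x y z t : ℝ) (hC : 1 < C) (hB : C ≤ B) (hA : B ≤ A)
    (hx : |x - A| ≤ 2) (hy : |y - B| ≤ 2) (hz : |z - C| ≤ 2) (ht0 : 0 ≤ t) (ht : t ≤ 1) :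
    |(x * y * z + t) / (A * B * C) - 1| ≤ 27 / C := by
  have hC0 : 0 < C := by linarith
  have hB0 : 0 < B := by linarith
  have hA0 : 0 < A := by linarith
  have red : ∀ p q : ℝ, C ≤ q → |p - q| ≤ 2 → |p / q - 1| ≤ 2 / C := by
    intro p q hq hp
    have hq0 : 0 < q := by linarith
    rw [div_sub_one hq0.ne', abs_div, abs_of_pos hq0]
    exact div_le_div₀ (by norm_num) hp hC0 hq
  have hu := red x A (hB.trans hA) hx
  have hv := red y B hB hy
  have hw := red z C le_rfl hz
  have hs : |t / (A * B * C)| ≤ 1 / C := by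
    rw [abs_of_nonneg (by positivity)]
    refine div_le_div₀ (by norm_num) ht hC0 ?_
    nlinarith [mul_pos hB0 hC0, mul_pos hA0 hB0]
  have hε : 1 / C ≤ 1 := by rw [div_le_one hC0]; linarith
  have hε0 : 0 < 1 / C := by positivity
  rw [show 2 / C = 2 * (1 / C) by ring] at hu hv hw
  rw [show 27 / C = 27 * (1 / C) by ring]
  set ε := 1 / C
  have hid : (x * y * z + t) / (A * B * C) - 1
      = (x / A - 1) + (y / B - 1) + (z / C - 1) + (x / A - 1) * (y / B - 1)
        + (x / A - 1) * (z / C - 1) + (y / B - 1) * (z / C - 1)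
        + (x / A - 1) * (y / B - 1) * (z / C - 1) + t / (A * B * C) := by
    field_simp; ring
  rw [hid]
  set u := x / A - 1
  set v := y / B - 1
  set w := z / C - 1
  have pr : ∀ p q P : ℝ, 0 ≤ P → |p| ≤ P → |q| ≤ 2 * ε → |p * q| ≤ 2 * P := by
    intro p q P hP hp hq
    rw [abs_mul]
    calc |p| * |q| ≤ P * 2 := mul_le_mul hp (by linarith) (abs_nonneg _) hP
      _ = 2 * P := by ring
  have h1 := pr u v _ (by linarith) hu hv
  have h2 := pr u w _ (by linarith) hu hw
  have h3 := pr v w _ (by linarith) hv hw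
  have h4 := pr (u * v) w _ (by linarith) h1 hw
  rw [abs_le] at *
  constructor <;> linarith [hu.1, hu.2, hv.1, hv.2, hw.1, hw.2, hs.1, hs.2]

theorem final_ineq_zero (A B C x y z t : ℝ) (hA : 1 < A) (hB : 1 / 2 < B) (hC : 1 / 2 < C)
    (hx0 : 0 ≤ x) (hy0 : 0 ≤ y) (hz0 : 0 ≤ z)
    (hx : x ≤ 3 * A) (hy : y ≤ 4 * B) (hz : z ≤ 4 * C) (ht0 : 0 ≤ t) (ht : t ≤ 1) :
    |(x * y * z + t) / (A * B * C) - 1| ≤ 52 := by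
  have hp : 1 / 4 < A * B * C := by
    have : 1 / 2 < A * B := by nlinarith
    nlinarith
  have hxyz : x * y * z ≤ (3 * A) * (4 * B) * (4 * C) := by gcongr
  have h0 : 0 ≤ (x * y * z + t) / (A * B * C) := by positivity
  have h1 : (x * y * z + t) / (A * B * C) ≤ 52 := by
    rw [div_le_iff₀ (by linarith)]; nlinarith
  rw [abs_le]; constructor <;> linarith

theorem linear_form_Lambda1_bound
    (k n m l d a : ℕ) (hk : 2 ≤ k) (hnm : m ≤ n) (hml : l ≤ m)
    (hd : 2 ≤ d) (ha1 : 1 ≤ a) (ha9 : a ≤ 9)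
    (heq : lucasK k n * lucasK k m * lucasK k l = a * ((10 ^ d - 1) / 9))
    (α : ℝ) (hroot : α ^ k = ∑ i ∈ Finset.range k, α ^ i)
    (hα₁ : 2 * (1 - (2 : ℝ) ^ (-(k : ℤ))) < α) (hα₂ : α < 2) :
    |α ^ (-((n : ℤ) + m + l - 3)) * 10 ^ d *
        ((α - 1) / (2 + ((k : ℝ) + 1) * (α - 2))) ^ (-3 : ℤ) *
        (2 * α - 1) ^ (-3 : ℤ) * ((a : ℝ) / 9) - 1|
      < 15 / α ^ ((l : ℤ) - 3) := by
  obtain ⟨h1, hα, hD, hc1, hc3⟩ := root_facts k hk α hroot hα₁ hα₂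
  have hα0 : 0 < α := by linarith
  have hcD : (α - 1) / (2 + ((k : ℝ) + 1) * (α - 2)) * (2 * α - 1)
      * (2 + ((k : ℝ) + 1) * (α - 2)) = (α - 1) * (2 * α - 1) := by
    field_simp
  rw [mul_assoc (_ * _) (_ ^ (-3 : ℤ)) (_ ^ (-3 : ℤ)), ← mul_zpow]
  set c := (α - 1) / (2 + ((k : ℝ) + 1) * (α - 2)) * (2 * α - 1) with hcdef
  clear_value c
  have herr := lucas_error k hk α c hroot h1 hα hα₂ hcD hc1 hc3
  have hc0 : 0 < c := by linarith
  -- the repdigit as a real number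
  have hrep : (lucasK k n : ℝ) * lucasK k m * lucasK k l + a / 9 = 10 ^ d * (a / 9) := by
    have hdvd : 9 ∣ 10 ^ d - 1 := by
      have := Nat.sub_one_dvd_pow_sub_one 10 d
      simpa using this
    obtain ⟨q, hq⟩ := hdvd
    have hq' : (10 : ℝ) ^ d = 9 * q + 1 := by
      have : 10 ^ d = 9 * q + 1 := by
        have : 0 < 10 ^ d := by positivity
        omega
      exact_mod_cast this
    rw [hq, Nat.mul_div_cancel_left _ (by norm_num)] at heq
    have : (lucasK k n : ℝ) * lucasK k m * lucasK k l = a * q := by exact_mod_cast heq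
    rw [this, hq']; ring
  have hexpr : α ^ (-((n : ℤ) + m + l - 3)) * 10 ^ d * c ^ (-3 : ℤ) * ((a : ℝ) / 9)
      = ((lucasK k n : ℝ) * lucasK k m * lucasK k l + a / 9) /
        ((c / α * α ^ n) * (c / α * α ^ m) * (c / α * α ^ l)) := by
    rw [hrep, zpow_neg, zpow_sub₀ hα0.ne', zpow_add₀ hα0.ne', zpow_add₀ hα0.ne', zpow_neg]
    simp only [zpow_natCast]
    norm_cast
    field_simp
  have hrhs : 15 / α ^ ((l : ℤ) - 3) = 15 * α ^ 3 / α ^ l := by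
    rw [zpow_sub₀ hα0.ne']
    simp only [zpow_natCast]
    norm_cast
    field_simp
  rw [hexpr, hrhs]
  have ht0 : (0 : ℝ) ≤ a / 9 := by positivity
  have ht1 : (a : ℝ) / 9 ≤ 1 := by
    rw [div_le_one (by norm_num)]; exact_mod_cast ha9
  have hcα : 0 < c / α := by positivity
  have hmono : ∀ i j : ℕ, i ≤ j → c / α * α ^ i ≤ c / α * α ^ j := fun i j hij =>
    mul_le_mul_of_nonneg_left (pow_le_pow_right₀ (by linarith) hij) hcα.le
  have hone : ∀ i : ℕ, 1 ≤ i → 1 < c / α * α ^ i := fun i hi => by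
    refine lt_of_lt_of_le ?_ (hmono 1 i hi)
    rw [pow_one, div_mul_cancel₀ _ hα0.ne']; exact hc1
  have hzero : 1 / 2 < c / α := by
    rw [lt_div_iff₀ hα0]; linarith
  have hhalf : ∀ i : ℕ, 1 / 2 < c / α * α ^ i := fun i => by
    refine lt_of_lt_of_le ?_ (hmono 0 i (Nat.zero_le _))
    simpa using hzero
  rcases Nat.eq_zero_or_pos l with hl | hl
  · have hn : 1 ≤ n := by
      by_contra hn
      obtain rfl : n = 0 := by omega
      obtain rfl : m = 0 := by omega
      subst hl
      have h11 : 11 ≤ (10 ^ d - 1) / 9 := by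
        have : 10 ^ 2 ≤ 10 ^ d := Nat.pow_le_pow_right (by norm_num) hd
        omega
      have h0 : lucasK k 0 = 2 := by rw [lucasK]
      rw [h0] at heq
      nlinarith
    have hr3 : ∀ i : ℕ, 1 ≤ i → (lucasK k i : ℝ) ≤ 3 * (c / α * α ^ i) := fun i hi => by
      have := (abs_le.1 (herr i)).2
      linarith [hone i hi]
    have hr4 : ∀ i : ℕ, (lucasK k i : ℝ) ≤ 4 * (c / α * α ^ i) := fun i => by
      rcases Nat.eq_zero_or_pos i with rfl | hi
      · rw [lucasK]; push_cast; linarith [hhalf 0]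
      · linarith [hr3 i hi, hhalf i]
    have := final_ineq_zero _ _ _ _ _ _ _ (hone n hn) (hhalf m) (hhalf l)
      (Nat.cast_nonneg _) (Nat.cast_nonneg _) (Nat.cast_nonneg _) (hr3 n hn) (hr4 m) (hr4 l) ht0 ht1
    refine lt_of_le_of_lt this ?_
    rw [hl, pow_zero, div_one]
    have : (1.6 : ℝ) ^ 3 < α ^ 3 := by gcongr
    norm_num at this
    linarith
  · have := final_ineq_pos _ _ _ _ _ _ _ (hone l hl) (hmono l m hml) (hmono m n hnm)
      (herr n) (herr m) (herr l) ht0 ht1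
    refine lt_of_le_of_lt this ?_
    have hpl : 0 < α ^ l := by positivity
    rw [div_lt_div_iff₀ (by positivity) hpl]
    have h38 : 27 < 15 * α ^ 2 * c := by nlinarith
    have : 15 * α ^ 3 * (c / α * α ^ l) = (15 * α ^ 2 * c) * α ^ l := by
      field_simp
    rw [this]
    exact mul_lt_mul_of_pos_right h38 hpl
end

section
/- Let k ≥ 2 and suppose nonnegative integers n ≥ m ≥ l ≥ 0, d ≥ 2, 1 ≤ a ≤ 9 satisfy L_n^{(k)} · L_m^{(k)} · L_l^{(k)} = a·(10^d − 1)/9. Then |α^{−(n−1)} · 10^d · f_k(α)^{−1} · (2α − 1)^{−1} · (L_m^{(k)})^{−1} · (L_l^{(k)})^{−1} · (a/9) − 1| < (5/2)/α^{n−1}, where α is the dominant root of x^k − x^{k−1} − ⋯ − x − 1. -/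
theorem aux_upper (k : ℕ) (hk : 2 ≤ k) (e : ℤ → ℝ) (b : ℕ → ℝ) (B : ℝ) (hB : 0 < B)
    (hb : ∀ j < k, 0 < b j)
    (hrec : ∀ n : ℤ, 2 ≤ n → e (n + 1) = 2 * e n - e (n - k))
    (hT : ∀ n : ℤ, 1 ≤ n → ∑ j ∈ Finset.range k, b j * e (n - j) = 0)
    (hinit : ∀ i : ℤ, 2 - (k : ℤ) ≤ i → i ≤ 1 → e i < B) :
    ∀ t : ℕ, ∀ i : ℤ, 2 - (k : ℤ) ≤ i → i ≤ 1 + t → e i < B := by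
  intro t
  induction t with
  | zero => intro i h1 h2; exact hinit i h1 (by simpa using h2)
  | succ t ih =>
    intro i h1 h2
    by_cases h3 : i ≤ 1 + t
    · exact ih i h1 h3
    have hi : i = 2 + t := by push_cast at h2; omega
    subst hi
    by_contra hcon
    push Not at hcon
    have key : ∀ s : ℕ, (∀ r : ℕ, r ≤ s → B ≤ e (2 + t + r)) ∧
        (∀ i : ℤ, 2 - (k : ℤ) ≤ i → i ≤ 2 + t + s → e i ≤ e (2 + t + s)) := by
      intro s
      induction s with
      | zero =>
        constructor
        · intro r hr
          obtain rfl : r = 0 := by omega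
          simpa using hcon
        · intro i h4 h5
          by_cases h6 : i ≤ 1 + t
          · have := ih i h4 h6
            simp only [Nat.cast_zero, add_zero]
            linarith
          · have : i = 2 + t + (0 : ℕ) := by push_cast at h5 ⊢; omega
            rw [this]
      | succ s ihs =>
        obtain ⟨h7, h8⟩ := ihs
        have h9 := hrec (2 + t + s) (by omega)
        have h10 := h8 (2 + t + s - k) (by omega) (by omega)
        have h11 : e (2 + t + s) ≤ e (2 + t + (s + 1 : ℕ)) := by
          have : (2 + t + (s + 1 : ℕ) : ℤ) = 2 + t + s + 1 := by push_cast; ring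
          rw [this]; linarith
        constructor
        · intro r hr
          by_cases h12 : r ≤ s
          · exact h7 r h12
          · obtain rfl : r = s + 1 := by omega
            exact (h7 s le_rfl).trans h11
        · intro i h4 h5
          by_cases h6 : i ≤ 2 + t + s
          · exact (h8 i h4 h6).trans h11
          · have : i = 2 + t + (s + 1 : ℕ) := by push_cast at h5 ⊢; omega
            rw [this]
    have hpos : 0 < ∑ j ∈ Finset.range k, b j * e (2 + t + k - j) := by
      apply Finset.sum_pos
      · intro j hj
        have hj' := Finset.mem_range.mp hj
        apply mul_pos (hb j hj')
        have := (key k).1 (k - j) (by omega)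
        have h13 : (2 + t + ((k - j : ℕ) : ℤ)) = 2 + t + k - j := by omega
        rw [h13] at this
        linarith
      · exact ⟨0, Finset.mem_range.mpr (by omega)⟩
    have := hT (2 + t + k) (by omega)
    linarith

/-- Lucas numbers extended by zero to negative indices. -/
noncomputable def lucZ (k : ℕ) (z : ℤ) : ℝ := if z < 0 then 0 else (lucasK k z.toNat : ℝ)

theorem lucZ_rec (k : ℕ) (n : ℤ) (hn : 2 ≤ n) :
    lucZ k n = ∑ j ∈ Finset.range k, lucZ k (n - 1 - j) := by
  obtain ⟨p, rfl⟩ : ∃ p : ℕ, n = p + 2 := ⟨(n - 2).toNat, by omega⟩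
  have h1 : lucZ k (p + 2) = (lucasK k (p + 2) : ℝ) := by
    unfold lucZ
    rw [if_neg (by omega)]
    congr 2
  rw [h1, lucasK]
  push_cast
  apply Finset.sum_congr rfl
  intro j hj
  unfold lucZ
  by_cases h : j ≤ p + 1
  · rw [dif_pos h, if_neg (by omega)]
    congr 2
    omega
  · rw [dif_neg h, if_pos (by omega)]
    simp

theorem lucasK_pos (k : ℕ) (hk : 2 ≤ k) (n : ℕ) : 1 ≤ lucasK k n := by
  induction n using Nat.strong_induction_on with
  | _ n ih =>
    match n with
    | 0 => simp [lucasK]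
    | 1 => simp [lucasK]
    | n + 2 =>
      rw [lucasK]
      have h0 : (0 : ℕ) ∈ Finset.range k := Finset.mem_range.mpr (by omega)
      have := Finset.single_le_sum (f := fun j => if _ : j ≤ n + 1 then lucasK k (n + 1 - j) else 0)
        (fun _ _ => Nat.zero_le _) h0
      refine le_trans ?_ this
      simpa using ih (n + 1) (by omega)

theorem alpha_facts (k : ℕ) (hk : 2 ≤ k) (α : ℝ) (hroot : α ^ k = ∑ i ∈ Finset.range k, α ^ i)
    (hα₁ : 2 * (1 - (2 : ℝ) ^ (-(k : ℤ))) < α) (hα₂ : α < 2) :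
    3 / 2 < α ∧ (2 - α) * α ^ k = 1 ∧ ((k : ℝ) - 1) * (2 - α) ≤ 1 / 2 := by
  have hz : (2 : ℝ) ^ (-(k : ℤ)) = (2 ^ k)⁻¹ := by simp
  rw [hz] at hα₁
  have hg : (∑ i ∈ Finset.range k, α ^ i) * (α - 1) = α ^ k - 1 := geom_sum_mul α k
  rw [← hroot] at hg
  have hmain : ((k : ℝ) - 1) * 4 ≤ 2 ^ k ∧ (4 : ℝ) ≤ 2 ^ k := by
    induction k, hk using Nat.le_induction with
    | base => norm_num
    | succ m hm ih =>
      clear ih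
      have : ∀ m : ℕ, 2 ≤ m → ((m : ℝ) - 1) * 4 ≤ 2 ^ m ∧ (4 : ℝ) ≤ 2 ^ m := by
        intro m hm
        induction m, hm using Nat.le_induction with
        | base => norm_num
        | succ m hm ih =>
          rw [pow_succ]; push_cast
          constructor <;> linarith [ih.1, ih.2]
      exact this _ (by omega)
  have hp : (0 : ℝ) < 2 ^ k := by positivity
  have hinv : ((2 : ℝ) ^ k)⁻¹ ≤ 1 / 4 := by
    rw [inv_le_comm₀ hp (by norm_num)]; linarith [hmain.2]
  refine ⟨by linarith, by linarith, ?_⟩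
  have hk1 : (0 : ℝ) ≤ (k : ℝ) - 1 := by
    have : (2 : ℝ) ≤ k := by exact_mod_cast hk
    linarith
  have h1 : ((k : ℝ) - 1) * (2 - α) ≤ ((k : ℝ) - 1) * (2 * (2 ^ k)⁻¹) :=
    mul_le_mul_of_nonneg_left (by linarith) hk1
  have h2 : ((k : ℝ) - 1) * (2 * (2 ^ k)⁻¹) ≤ 1 / 2 := by
    have : ((k : ℝ) - 1) * (2 * (2 ^ k)⁻¹) = (((k : ℝ) - 1) * 4) * (2 ^ k)⁻¹ / 2 := by ring
    rw [this]
    have h3 := mul_le_mul_of_nonneg_right hmain.1 (inv_nonneg.mpr hp.le)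
    rw [mul_inv_cancel₀ hp.ne'] at h3
    linarith
  linarith

theorem err_bound (k : ℕ) (hk : 2 ≤ k) (α C : ℝ) (ha : 3 / 2 < α) (hα₂ : α < 2)
    (hP : (2 - α) * α ^ k = 1)
    (hC : C * (α - k * (2 - α)) = (α - 1) * (2 * α - 1)) (hC1 : 1 < C) (hC2 : C < 5 / 2)
    (n : ℕ) : |(lucasK k n : ℝ) - C * α ^ ((n : ℤ) - 1)| < 3 / 2 := by
  have hα0 : α ≠ 0 := by linarith
  have hα1 : α - 1 ≠ 0 := by linarith
  have hαp : 0 < α := by linarith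
  set e : ℤ → ℝ := fun z => lucZ k z - C * α ^ (z - 1) with he
  set b : ℕ → ℝ := fun j => (1 - (2 - α) * α ^ j) / (α - 1) with hbdef
  have hb0 : b 0 = 1 := by
    simp only [hbdef]; rw [div_eq_one_iff_eq hα1]; ring
  have hbk : b k = 0 := by simp only [hbdef]; rw [hP]; simp
  have hbs : ∀ j, b (j + 1) = α * b j - 1 := by
    intro j; simp only [hbdef]; field_simp; ring
  have hbpos : ∀ j < k, 0 < b j := by
    intro j hj
    have h1 : α ^ j < α ^ k := pow_lt_pow_right₀ (by linarith) hj
    have h2 : (2 - α) * α ^ j < (2 - α) * α ^ k := mul_lt_mul_of_pos_left h1 (by linarith)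
    apply div_pos <;> linarith
  have hgeo : ∑ j ∈ Finset.range k, α⁻¹ ^ j = α := by
    have h1 : α⁻¹ ≠ 1 := by
      intro h; have := inv_eq_one.mp h; linarith
    rw [geom_sum_eq h1]
    have h2 : α⁻¹ ^ k = 2 - α := by
      rw [inv_pow]; exact (eq_inv_of_mul_eq_one_left hP).symm
    rw [h2]
    have h3 : α⁻¹ - 1 ≠ 0 := sub_ne_zero.mpr h1
    rw [div_eq_iff h3]; field_simp; ring
  have hpw : ∀ (z : ℤ) (j : ℕ), α ^ (z - j) = α ^ z * α⁻¹ ^ j := by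
    intro z j
    rw [zpow_sub₀ hα0, zpow_natCast, inv_pow, div_eq_mul_inv]
  have hrec : ∀ z : ℤ, 2 ≤ z → e z = ∑ j ∈ Finset.range k, e (z - 1 - j) := by
    intro z hz
    simp only [he]
    rw [Finset.sum_sub_distrib, ← lucZ_rec k z hz, ← Finset.mul_sum]
    congr 2
    have : ∀ j ∈ Finset.range k, α ^ (z - 1 - (j : ℤ) - 1) = α ^ (z - 2) * α⁻¹ ^ j := by
      intro j _
      rw [← hpw]; congr 1; ring
    rw [Finset.sum_congr rfl this, ← Finset.mul_sum, hgeo, ← zpow_add_one₀ hα0]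
    congr 1; ring
  have hrec2 : ∀ z : ℤ, 2 ≤ z → e (z + 1) = 2 * e z - e (z - k) := by
    intro z hz
    have h1 := Finset.sum_range_succ (fun j : ℕ => e (z - j)) k
    rw [Finset.sum_range_succ'] at h1
    have h2 := hrec z hz
    have h3 := hrec (z + 1) (by omega)
    have h4 : ∀ j ∈ Finset.range k, e (z - ((j + 1 : ℕ) : ℤ)) = e (z - 1 - j) := by
      intro j _; congr 1; push_cast; ring
    rw [Finset.sum_congr rfl h4, ← h2] at h1
    simp only [add_sub_cancel_right] at h3
    simp only [Nat.cast_zero, sub_zero] at h1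
    linarith
  have hT1 : ∑ j ∈ Finset.range k, b j * e (1 - j) = 0 := by
    have h1 : ∑ j ∈ Finset.range k, b j * lucZ k (1 - j) = 2 * α - 1 := by
      obtain ⟨q, rfl⟩ : ∃ q, k = q + 2 := ⟨k - 2, by omega⟩
      rw [Finset.sum_range_succ', Finset.sum_range_succ', Finset.sum_eq_zero]
      · have := hbs 0
        rw [hb0] at this
        simp only [zero_add] at this ⊢
        rw [hb0, this]
        norm_num [lucZ, lucasK]
        ring
      · intro j _
        unfold lucZ
        rw [if_pos (by push_cast; omega)]; simp
    have h2 : ∑ j ∈ Finset.range k, b j * α ^ (((1 : ℤ) - j) - 1) = (α - k * (2 - α)) / (α - 1) := by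
      have : ∀ j ∈ Finset.range k, b j * α ^ (((1 : ℤ) - j) - 1)
          = (α⁻¹ ^ j - (2 - α)) / (α - 1) := by
        intro j _
        have h5 : ((1 : ℤ) - j) - 1 = 0 - j := by ring
        rw [h5, hpw]
        have h6 : α ^ j * α⁻¹ ^ j = 1 := by rw [← mul_pow, mul_inv_cancel₀ hα0, one_pow]
        simp only [hbdef, zpow_zero, one_mul]
        rw [div_mul_eq_mul_div]
        congr 1
        linear_combination (-(2 - α)) * h6
      rw [Finset.sum_congr rfl this, ← Finset.sum_div, Finset.sum_sub_distrib, hgeo]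
      simp [mul_sub]
    have h3 : ∑ j ∈ Finset.range k, b j * e (1 - j) =
        ∑ j ∈ Finset.range k, b j * lucZ k (1 - j)
        - C * ∑ j ∈ Finset.range k, b j * α ^ (((1 : ℤ) - j) - 1) := by
      rw [Finset.mul_sum, ← Finset.sum_sub_distrib]
      apply Finset.sum_congr rfl
      intro j _
      simp only [he]; ring
    rw [h3, h1, h2, ← mul_div_assoc, hC, mul_div_cancel_left₀ _ hα1, sub_self]
  have hTs : ∀ z : ℤ, 1 ≤ z → ∑ j ∈ Finset.range k, b j * e (z + 1 - j)
      = α * ∑ j ∈ Finset.range k, b j * e (z - j) := by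
    intro z hz
    have h1 := Finset.sum_range_succ (fun j : ℕ => b j * e (z + 1 - j)) k
    rw [Finset.sum_range_succ'] at h1
    have h3 := hrec (z + 1) (by omega)
    simp only [add_sub_cancel_right] at h3
    have h4 : ∀ j ∈ Finset.range k, b (j + 1) * e (z + 1 - ((j + 1 : ℕ) : ℤ))
        = α * (b j * e (z - j)) - e (z - j) := by
      intro j _
      have : z + 1 - ((j + 1 : ℕ) : ℤ) = z - j := by push_cast; ring
      rw [this, hbs]; ring
    rw [Finset.sum_congr rfl h4, Finset.sum_sub_distrib, ← h3, ← Finset.mul_sum, hb0, hbk] at h1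
    simp only [Nat.cast_zero, sub_zero] at h1
    linarith
  have hT : ∀ z : ℤ, 1 ≤ z → ∑ j ∈ Finset.range k, b j * e (z - j) = 0 := by
    intro z hz
    induction z, hz using Int.le_induction with
    | base => exact hT1
    | succ z hz ih => rw [hTs z hz, ih, mul_zero]
  have hinit : ∀ i : ℤ, 2 - (k : ℤ) ≤ i → i ≤ 1 → e i < 3 / 2 ∧ - e i < 3 / 2 := by
    intro i _ hi
    rcases (by omega : i = 1 ∨ i = 0 ∨ i ≤ -1) with rfl | rfl | hi'
    · norm_num [he, lucZ, lucasK]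
      constructor <;> linarith
    · have h1 : (1 : ℝ) / 2 < α⁻¹ := by
        rw [one_div]; exact (inv_lt_inv₀ (by norm_num) hαp).mpr hα₂
      have h2 : α⁻¹ < 1 := inv_lt_one_of_one_lt₀ (by linarith)
      norm_num [he, lucZ, lucasK]
      constructor <;> nlinarith
    · have h0 : lucZ k i = 0 := by unfold lucZ; rw [if_pos (by omega)]
      have h1 : 0 < α ^ (i - 1) := zpow_pos hαp _
      have h2 : α ^ (i - 1) ≤ α ^ (-2 : ℤ) := zpow_le_zpow_right₀ (by linarith) (by omega)
      have h3 : α ^ (-2 : ℤ) ≤ 4 / 9 := by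
        have : α ^ (-2 : ℤ) = (α ^ 2)⁻¹ := by
          rw [zpow_neg]; norm_cast
        rw [this, inv_le_comm₀ (by positivity) (by norm_num)]
        nlinarith
      simp only [he, h0]
      constructor <;> nlinarith
  have hen : e n = (lucasK k n : ℝ) - C * α ^ ((n : ℤ) - 1) := by
    simp only [he, lucZ]
    rw [if_neg (by omega)]; simp
  rw [← hen, abs_lt]
  have hup := aux_upper k hk e b (3 / 2) (by norm_num) hbpos hrec2 hT
    (fun i h1 h2 => (hinit i h1 h2).1) n n (by omega) (by omega)
  have hlo := aux_upper k hk (fun z => - e z) b (3 / 2) (by norm_num) hbpos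
    (fun z hz => by rw [hrec2 z hz]; ring)
    (fun z hz => by
      have := hT z hz
      simp only [mul_neg, Finset.sum_neg_distrib, this, neg_zero])
    (fun i h1 h2 => (hinit i h1 h2).2) n n (by omega) (by omega)
  constructor
  · linarith
  · exact hup

theorem linear_form_Lambda3_bound
    (k n m l d a : ℕ) (hk : 2 ≤ k) (hnm : m ≤ n) (hml : l ≤ m)
    (hd : 2 ≤ d) (ha1 : 1 ≤ a) (ha9 : a ≤ 9)
    (heq : lucasK k n * lucasK k m * lucasK k l = a * ((10 ^ d - 1) / 9))
    (α : ℝ) (hroot : α ^ k = ∑ i ∈ Finset.range k, α ^ i)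
    (hα₁ : 2 * (1 - (2 : ℝ) ^ (-(k : ℤ))) < α) (hα₂ : α < 2) :
    |α ^ (-((n : ℤ) - 1)) * 10 ^ d *
        ((α - 1) / (2 + ((k : ℝ) + 1) * (α - 2)))⁻¹ * (2 * α - 1)⁻¹ *
        ((lucasK k m : ℝ))⁻¹ * ((lucasK k l : ℝ))⁻¹ * ((a : ℝ) / 9) - 1|
      < (5 / 2) / α ^ ((n : ℤ) - 1) := by
  obtain ⟨h32, hP, hk2⟩ := alpha_facts k hk α hroot hα₁ hα₂
  have hkR : (2 : ℝ) ≤ k := by exact_mod_cast hk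
  have hden : 0 < 2 + ((k : ℝ) + 1) * (α - 2) := by nlinarith
  set C : ℝ := (α - 1) / (2 + ((k : ℝ) + 1) * (α - 2)) * (2 * α - 1) with hCdef
  have hC : C * (2 + ((k : ℝ) + 1) * (α - 2)) = (α - 1) * (2 * α - 1) := by
    rw [hCdef]; field_simp
  have hC1 : 1 < C := by
    have : 2 + ((k : ℝ) + 1) * (α - 2) < C * (2 + ((k : ℝ) + 1) * (α - 2)) := by
      rw [hC]; nlinarith
    by_contra h
    push Not at h
    nlinarith
  have hC2 : C < 5 / 2 := by
    have : C * (2 + ((k : ℝ) + 1) * (α - 2)) < 5 / 2 * (2 + ((k : ℝ) + 1) * (α - 2)) := by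
      rw [hC]; nlinarith
    exact lt_of_mul_lt_mul_right this hden.le
  have herr := err_bound k hk α C h32 hα₂ hP
    (by rw [← hC]; ring) hC1 hC2 n
  have hm : (1 : ℝ) ≤ lucasK k m := by exact_mod_cast lucasK_pos k hk m
  have hl : (1 : ℝ) ≤ lucasK k l := by exact_mod_cast lucasK_pos k hk l
  have heqR : (lucasK k n : ℝ) * lucasK k m * lucasK k l = a * ((10 ^ d - 1) / 9) := by
    obtain ⟨q, hq⟩ : 9 ∣ 10 ^ d - 1 := by
      have := Nat.sub_dvd_pow_sub_pow 10 1 d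
      simpa using this
    have h1 : 1 ≤ 10 ^ d := Nat.one_le_pow _ _ (by norm_num)
    rw [hq, Nat.mul_div_cancel_left _ (by norm_num)] at heq
    have h2 : (10 : ℝ) ^ d - 1 = 9 * q := by
      have : 10 ^ d = 9 * q + 1 := by omega
      have : (10 : ℝ) ^ d = 9 * q + 1 := by exact_mod_cast this
      linarith
    rw [h2, mul_div_cancel_left₀ _ (by norm_num)]
    exact_mod_cast heq
  have hpow : 0 < α ^ ((n : ℤ) - 1) := zpow_pos (by linarith) _
  rw [zpow_neg]
  set P := α ^ ((n : ℤ) - 1) with hPdef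
  set x : ℝ := (lucasK k n : ℝ) with hx
  set y : ℝ := (lucasK k m : ℝ) with hy
  set z : ℝ := (lucasK k l : ℝ) with hz
  have hC0 : 0 < C := by linarith
  have hrew : P⁻¹ * 10 ^ d * ((α - 1) / (2 + ((k : ℝ) + 1) * (α - 2)))⁻¹ * (2 * α - 1)⁻¹ *
        y⁻¹ * z⁻¹ * ((a : ℝ) / 9) - 1 = ((x - C * P) + (a / 9) / (y * z)) / (C * P) := by
    have h1 : ((α - 1) / (2 + ((k : ℝ) + 1) * (α - 2)))⁻¹ * (2 * α - 1)⁻¹ = C⁻¹ := by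
      rw [hCdef, mul_inv]
    have h2 : P⁻¹ * 10 ^ d * ((α - 1) / (2 + ((k : ℝ) + 1) * (α - 2)))⁻¹ * (2 * α - 1)⁻¹ *
        y⁻¹ * z⁻¹ * ((a : ℝ) / 9) = P⁻¹ * 10 ^ d * C⁻¹ * y⁻¹ * z⁻¹ * ((a : ℝ) / 9) := by
      rw [← h1]; ring
    rw [h2]
    clear_value C P x y z
    have hy0 : y ≠ 0 := by linarith
    have hz0 : z ≠ 0 := by linarith
    field_simp
    linear_combination (-9) * heqR
  rw [hrew, abs_div, abs_of_pos (mul_pos hC0 hpow)]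
  have hyz : 1 ≤ y * z := by nlinarith
  have ha9' : (a : ℝ) ≤ 9 := by exact_mod_cast ha9
  have hq1 : (a / 9 : ℝ) / (y * z) ≤ 1 := by
    rw [div_le_one (by linarith)]; linarith
  have hq0 : 0 ≤ (a / 9 : ℝ) / (y * z) := by positivity
  have hnum : |(x - C * P) + (a / 9) / (y * z)| < 5 / 2 := by
    rw [abs_lt] at herr ⊢
    constructor <;> linarith [herr.1, herr.2]
  calc |(x - C * P) + (a / 9) / (y * z)| / (C * P) < (5 / 2) / (C * P) :=
        div_lt_div_of_pos_right hnum (mul_pos hC0 hpow)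
    _ ≤ (5 / 2) / P := by
        apply div_le_div_of_nonneg_left (by norm_num) hpow
        nlinarith
end
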